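/- Let G be a connected (n,k,λ,μ)-strongly regular graph on vertex set V that is not complete (there exist two distinct non-adjacent vertices) and is not a complete bipartite graph K_{m,m} (i.e., not both λ = 0 and μ = k), with integer Laplacian L. Let r ≥ 1 and suppose given edges u_i v_i (so u_i adjacent to v_i) for i ∈ Fin r. For each i define f_i : V → ℤ by f_i(u_i) = k + μ − λ − 1, f_i(v_i) = −(k + μ − λ − 1), and f_i(w) = (1 if w adjacent to u_i else 0) − (1 if w adjacent to v_i else 0) for w ∉ {u_i, v_i}. Assume the edges are pairwise orthogonal for the monodromy pairing: for all i ≠ j, f_i(u_j) = f_i(v_j). Let η = k·n / gcd(2·(n−1), k·n). Then there is an injective additive group homomorphism from ℤ/(n·μ)ℤ × (Fin (r−1) → ℤ/ηℤ) into the critical group K(G); that is, K(G) contains a subgroup isomorphic to ℤ/nμℤ ⊕ (ℤ/ηℤ)^{r−1}. -/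

import Mathlib

open Finset

/-- The subgroup of integer vectors whose coordinates sum to zero. -/
def sumZero (V : Type*) [Fintype V] : AddSubgroup (V → ℤ) where
  carrier := {x | ∑ v, x v = 0}
  add_mem' {a b} ha hb := by
    simp only [Set.mem_setOf_eq] at *
    simp [Finset.sum_add_distrib, ha, hb]
  zero_mem' := by simp
  neg_mem' {a} ha := by
    simp only [Set.mem_setOf_eq] at *
    simp [ha]

/-- The ℤ-span of the rows of an integer matrix, as an additive subgroup of `V → ℤ`. -/
def rowSpan {V : Type*} [Fintype V] (L : Matrix V V ℤ) : AddSubgroup (V → ℤ) :=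
  (Submodule.span ℤ (Set.range fun w => L w)).toAddSubgroup

/-- The critical group of a graph: the quotient of the sum-zero vectors by the
row span of the Laplacian. -/
def critGroup {V : Type*} [Fintype V] [DecidableEq V] (G : SimpleGraph V)
    [DecidableRel G.Adj] :=
  sumZero V ⧸ (rowSpan (G.lapMatrix ℤ)).addSubgroupOf (sumZero V)

noncomputable instance {V : Type*} [Fintype V] [DecidableEq V] (G : SimpleGraph V)
    [DecidableRel G.Adj] : AddCommGroup (critGroup G) :=
  QuotientAddGroup.Quotient.addCommGroup _

/-- The vector `e_u - e_v`, as an element of the sum-zero subgroup. -/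
def chipDiff {V : Type*} [Fintype V] [DecidableEq V] (u v : V) : sumZero V :=
  ⟨Pi.single u 1 - Pi.single v 1, by
    show ∑ w, (Pi.single u 1 - Pi.single v 1 : V → ℤ) w = 0
    simp [Finset.sum_sub_distrib, Finset.sum_pi_single]⟩


/-- Smith normal form consequence. -/
lemma snf_aux {m : ℕ} (M : Submodule ℤ (Fin m → ℤ)) (N η : ℤ) (hN : N ≠ 0)
    (h1 : ∀ x : Fin m → ℤ, N • x ∈ M) (h2 : ∀ x ∈ M, ∀ i, η ∣ x i) :
    ∃ X : Fin m → (Fin m → ℤ), (∀ i, η • X i ∈ M) ∧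
      ∀ t : Fin m → ℤ, ∑ i, t i • X i ∈ M → ∀ i, η ∣ t i := by
  have hrank : Module.finrank ℤ M = Module.finrank ℤ (Fin m → ℤ) := by
    apply le_antisymm
    · exact Submodule.finrank_le M
    · let g : (Fin m → ℤ) →ₗ[ℤ] M :=
        LinearMap.codRestrict M (N • LinearMap.id) (fun x => h1 x)
      have hg : Function.Injective g := by
        intro x y hxy
        have := congrArg Subtype.val hxy
        simp only [g, LinearMap.codRestrict_apply, LinearMap.smul_apply, LinearMap.id_apply] at this
        exact smul_right_injective _ hN this
      exact LinearMap.finrank_le_finrank_of_injective hg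
  obtain ⟨b, a, ab, hab⟩ := Submodule.exists_smith_normal_form_of_rank_eq
    (Pi.basisFun ℤ (Fin m)) hrank
  have ha : ∀ i, η ∣ a i := by
    intro i
    have hm : a i • b i ∈ M := by rw [← hab]; exact (ab i).2
    have hd := h2 _ hm
    choose y hy using hd
    have he : a i • b i = η • y := by
      ext j; rw [hy j]; simp
    have := congrArg (fun z => b.repr z i) he
    simp only [map_smul, Finsupp.smul_apply, Module.Basis.repr_self, Finsupp.single_eq_same,
      smul_eq_mul, mul_one] at this
    exact ⟨_, this⟩
  choose c hc using ha
  refine ⟨fun i => c i • b i, ?_, ?_⟩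
  · intro i
    rw [smul_smul, ← hc, ← hab]; exact (ab i).2
  · intro t ht i
    have hne : a i ≠ 0 := by
      intro h0
      have := hab i
      rw [h0, zero_smul] at this
      exact ab.ne_zero i (Subtype.ext this)
    have hci : c i ≠ 0 := by
      intro h0; apply hne; rw [hc, h0, mul_zero]
    set z : M := ⟨_, ht⟩ with hz
    have hs : z = ∑ j, ab.repr z j • ab j := (ab.sum_repr z).symm
    have hs' := congrArg (fun q : M => b.repr (q : Fin m → ℤ) i) hs
    simp only [hz] at hs'
    simp only [Submodule.coe_sum, Submodule.coe_smul, hab, smul_smul, map_sum,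
      map_smul, Module.Basis.repr_self, Finsupp.coe_finsetSum, Finset.sum_apply,
      Finsupp.smul_apply, smul_eq_mul, Finsupp.single_apply, mul_ite, mul_one, mul_zero,
      Finset.sum_ite_eq', Finset.mem_univ, if_true] at hs'
    rw [hc i] at hs'
    generalize ab.repr _ i = y at hs'
    refine ⟨y, mul_right_cancel₀ hci (hs'.trans ?_)⟩
    ring

lemma abstract_aux {K : Type*} [AddCommGroup K] (N η m : ℕ) (hN : N ≠ 0)
    (D0 : K) (D : Fin m → K) (hD0 : (N : ℤ) • D0 = 0) (hD : ∀ i, (N : ℤ) • D i = 0)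
    (c : Fin m → ℤ)
    (h : ∀ (a : ℤ) (b : Fin m → ℤ), a • D0 + ∑ i, b i • D i = 0 →
      (N : ℤ) ∣ a + ∑ i, b i * c i ∧ ∀ i, (η : ℤ) ∣ b i) :
    ∃ φ : ZMod N × (Fin m → ZMod η) →+ K, Function.Injective φ := by
  let E : Fin m → K := fun i => D i - c i • D0
  have hE : ∀ (a : ℤ) (b : Fin m → ℤ), a • D0 + ∑ i, b i • E i = 0 →
      (N : ℤ) ∣ a ∧ ∀ i, (η : ℤ) ∣ b i := by
    intro a b hab
    have := h (a - ∑ i, b i * c i) b (by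
      rw [← hab]
      simp only [E, smul_sub, Finset.sum_sub_distrib, sub_smul, Finset.sum_smul, smul_smul]
      abel)
    simpa using this
  let Λ : (Fin m → ℤ) →ₗ[ℤ] K := Fintype.linearCombination ℤ E
  have hΛ : ∀ b, Λ b = ∑ i, b i • E i := fun b => Fintype.linearCombination_apply _ _ _
  obtain ⟨X, hX1, hX2⟩ := snf_aux (LinearMap.ker Λ) N η (by exact_mod_cast hN)
    (by
      intro x
      rw [LinearMap.mem_ker, map_smul, hΛ, Finset.smul_sum]
      apply Finset.sum_eq_zero
      intro i _
      simp only [E]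
      rw [smul_comm, smul_sub, hD, smul_comm, hD0]; simp)
    (by
      intro x hx
      rw [LinearMap.mem_ker, hΛ] at hx
      exact (hE 0 x (by simpa using hx)).2)
  let φ1 : ZMod N →+ K := ZMod.lift N ⟨(zmultiplesHom K) D0, by simpa using hD0⟩
  let φ2 : Fin m → (ZMod η →+ K) := fun i =>
    ZMod.lift η ⟨(zmultiplesHom K) (Λ (X i)), by
      have := hX1 i
      rw [LinearMap.mem_ker, map_smul] at this
      simpa using this⟩
  let φ : ZMod N × (Fin m → ZMod η) →+ K :=
    φ1.coprod (∑ i, (φ2 i).comp (Pi.evalAddMonoidHom _ i))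
  refine ⟨φ, ?_⟩
  rw [injective_iff_map_eq_zero]
  rintro ⟨a, t⟩ hat
  obtain ⟨a, rfl⟩ := ZMod.intCast_surjective a
  have : ∃ s : Fin m → ℤ, t = fun i => (s i : ZMod η) := by
    choose s hs using fun i => ZMod.intCast_surjective (t i)
    exact ⟨s, funext fun i => (hs i).symm⟩
  obtain ⟨s, rfl⟩ := this
  have h0 : a • D0 + Λ (∑ i, s i • X i) = 0 := by
    rw [← hat]
    simp only [map_sum, map_smul]
    simp [φ, φ1, φ2, ZMod.lift_coe]
  rw [hΛ] at h0
  have h1 := hE _ _ h0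
  have ha0 : a • D0 = 0 := by
    obtain ⟨q, rfl⟩ := h1.1
    rw [mul_comm, mul_smul, hD0, smul_zero]
  rw [ha0, zero_add, ← hΛ] at h0
  have h2 := hX2 s h0
  ext
  · simpa [ZMod.intCast_zmod_eq_zero_iff_dvd] using h1.1
  · rename_i i
    simpa [ZMod.intCast_zmod_eq_zero_iff_dvd] using h2 i

section graph
variable {V : Type*} [Fintype V] [DecidableEq V] {G : SimpleGraph V}
    [DecidableRel G.Adj] {n k l μ : ℕ}

lemma mu_pos (hsrg : G.IsSRGWith n k l μ) (hconn : G.Connected)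
    (hnc : ∃ x y : V, x ≠ y ∧ ¬G.Adj x y) : 0 < μ := by
  rw [Nat.pos_iff_ne_zero]
  rintro rfl
  obtain ⟨x, y, hxy, hn⟩ := hnc
  obtain ⟨p⟩ := hconn.preconnected x y
  have key : ∀ {a c : V} (p : G.Walk a c), a = c ∨ G.Adj a c := by
    intro a c p
    induction p with
    | nil => left; rfl
    | @cons a b c hab p ih =>
      rcases ih with rfl | hbc
      · right; exact hab
      · by_contra! hcon
        have := hsrg.of_not_adj hcon.1 hcon.2
        rw [Fintype.card_eq_zero_iff] at this
        exact this.false ⟨b, hab, hbc.symm⟩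
  rcases key p with h | h
  · exact hxy h
  · exact hn h

lemma k_add_two_le (hsrg : G.IsSRGWith n k l μ)
    (hnc : ∃ x y : V, x ≠ y ∧ ¬G.Adj x y) : k + 2 ≤ n := by
  obtain ⟨x, y, hxy, hn⟩ := hnc
  have h1 : G.neighborFinset x ⊆ univ \ {x, y} := by
    intro w hw
    rw [SimpleGraph.mem_neighborFinset] at hw
    simp only [mem_sdiff, mem_univ, true_and, mem_insert, mem_singleton, not_or]
    exact ⟨hw.ne', fun h => hn (h ▸ hw)⟩
  have h2 := card_le_card h1
  rw [SimpleGraph.card_neighborFinset_eq_degree, hsrg.regular x,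
    card_sdiff_of_subset (subset_univ _), card_univ, hsrg.card, card_pair hxy] at h2
  have h3 : 2 ≤ n := by
    rw [← hsrg.card, ← card_pair hxy]; exact card_le_univ _
  omega

lemma l_lt (hsrg : G.IsSRGWith n k l μ) {a b : V} (h : G.Adj a b) : l < k := by
  have := h.card_commonNeighbors_lt_degree
  rwa [hsrg.of_adj _ _ h, hsrg.regular a] at this

lemma l_add_one_lt (hsrg : G.IsSRGWith n k l μ) (hμ : 0 < μ) (hk : k + 2 ≤ n)
    {a b : V} (h : G.Adj a b) : l + 1 < k := by
  have h1 := l_lt hsrg h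
  have h2 := hsrg.param_eq G (by omega)
  have h3 : 0 < (n - k - 1) * μ := Nat.mul_pos (by omega) hμ
  rw [← h2] at h3
  have := Nat.pos_of_mul_pos_left h3
  omega

lemma param_int (hsrg : G.IsSRGWith n k l μ) (hk : k + 2 ≤ n) (hl : l + 1 < k) :
    (k : ℤ) * ((k : ℤ) + μ - l - 1) = (n - 1) * μ := by
  have h2 := hsrg.param_eq G (by omega)
  have h3 : ((k : ℤ)) * ((k : ℤ) - l - 1) = ((n : ℤ) - k - 1) * μ := by
    have := congrArg (Nat.cast : ℕ → ℤ) h2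
    rw [Nat.cast_mul, Nat.cast_mul, Nat.sub_sub, Nat.sub_sub, Nat.cast_sub (by omega),
      Nat.cast_sub (by omega)] at this
    push_cast at this
    linarith
  linarith

/-- The auxiliary matrix. -/
def auxP (G : SimpleGraph V) [DecidableRel G.Adj] (k l μ : ℕ) : Matrix V V ℤ :=
  G.adjMatrix ℤ + ((k : ℤ) - l + μ) • (1 : Matrix V V ℤ)

lemma lap_eq (hsrg : G.IsSRGWith n k l μ) :
    G.lapMatrix ℤ = (k : ℤ) • (1 : Matrix V V ℤ) - G.adjMatrix ℤ := by
  ext i j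
  rw [Matrix.sub_apply, Matrix.smul_apply]
  simp [SimpleGraph.lapMatrix, SimpleGraph.degMatrix, Matrix.diagonal_apply, Matrix.one_apply,
    hsrg.regular.degree_eq]

lemma compl_adj_eq : Gᶜ.adjMatrix ℤ = Matrix.of (fun _ _ => 1) - 1 - G.adjMatrix ℤ := by
  ext i j
  by_cases h : i = j
  · subst h; simp
  · by_cases h' : G.Adj i j <;> simp [h, h', Matrix.one_apply]

lemma lap_mul_P (hsrg : G.IsSRGWith n k l μ) (hk : k + 2 ≤ n) (hl : l + 1 < k) :
    G.lapMatrix ℤ * auxP G k l μ =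
      ((n : ℤ) * μ) • (1 : Matrix V V ℤ) - (μ : ℤ) • Matrix.of (fun _ _ => 1) := by
  have h1 := hsrg.matrix_eq (α := ℤ)
  rw [compl_adj_eq] at h1
  have h2 := param_int hsrg hk hl
  rw [lap_eq hsrg, auxP]
  have e : ((k : ℤ) • (1 : Matrix V V ℤ) - G.adjMatrix ℤ) *
      (G.adjMatrix ℤ + ((k : ℤ) - l + μ) • (1 : Matrix V V ℤ)) =
      ((l : ℤ) - μ) • G.adjMatrix ℤ + ((k : ℤ) * ((k : ℤ) - l + μ)) • (1 : Matrix V V ℤ)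
        - G.adjMatrix ℤ ^ 2 := by
    simp only [sub_mul, mul_add, smul_mul_assoc, one_mul, mul_smul_comm, mul_one, pow_two,
      smul_smul]
    module
  rw [e, h1]
  have h3 : ((k : ℤ) * ((k : ℤ) - l + μ)) = n * μ + k - μ := by linarith
  rw [h3]
  module

lemma P_symm : (auxP G k l μ).IsSymm := by
  unfold auxP
  apply Matrix.IsSymm.add
  · exact G.isSymm_adjMatrix
  · exact Matrix.IsSymm.smul Matrix.isSymm_one _

lemma P_mul_lap (hsrg : G.IsSRGWith n k l μ) (hk : k + 2 ≤ n) (hl : l + 1 < k) :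
    auxP G k l μ * G.lapMatrix ℤ =
      ((n : ℤ) * μ) • (1 : Matrix V V ℤ) - (μ : ℤ) • Matrix.of (fun _ _ => 1) := by
  have := congrArg Matrix.transpose (lap_mul_P hsrg hk hl)
  rw [Matrix.transpose_mul, P_symm.eq, (SimpleGraph.isSymm_lapMatrix (R := ℤ) G).eq] at this
  rw [this]
  rw [Matrix.transpose_sub, Matrix.transpose_smul, Matrix.transpose_smul, Matrix.transpose_one]
  rfl

lemma mem_rowSpan_iff (L : Matrix V V ℤ) (x : V → ℤ) :
    x ∈ rowSpan L ↔ ∃ g : V → ℤ, Matrix.vecMul g L = x := by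
  unfold rowSpan
  rw [Submodule.mem_toAddSubgroup, Submodule.mem_span_range_iff_exists_fun]
  apply exists_congr
  intro g
  rw [Matrix.vecMul_eq_sum]

lemma smul_mem (hsrg : G.IsSRGWith n k l μ) (hk : k + 2 ≤ n) (hl : l + 1 < k)
    (x : V → ℤ) (hx : ∑ v, x v = 0) : ((n : ℤ) * μ) • x ∈ rowSpan (G.lapMatrix ℤ) := by
  rw [mem_rowSpan_iff]
  refine ⟨Matrix.vecMul x (auxP G k l μ), ?_⟩
  rw [Matrix.vecMul_vecMul, P_mul_lap hsrg hk hl, Matrix.vecMul_sub, Matrix.vecMul_smul,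
    Matrix.vecMul_smul, Matrix.vecMul_one]
  ext i
  simp [Matrix.vecMul, dotProduct, hx]

lemma dvd_of_mem (hsrg : G.IsSRGWith n k l μ) (hk : k + 2 ≤ n) (hl : l + 1 < k)
    (x : V → ℤ) (hx : x ∈ rowSpan (G.lapMatrix ℤ)) (w w' : V) :
    ((n : ℤ) * μ) ∣ Matrix.vecMul x (auxP G k l μ) w - Matrix.vecMul x (auxP G k l μ) w' := by
  rw [mem_rowSpan_iff] at hx
  obtain ⟨g, rfl⟩ := hx
  rw [Matrix.vecMul_vecMul, lap_mul_P hsrg hk hl, Matrix.vecMul_sub, Matrix.vecMul_smul,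
    Matrix.vecMul_smul, Matrix.vecMul_one]
  refine ⟨g w - g w', ?_⟩
  simp [Matrix.vecMul, dotProduct]
  ring

lemma auxP_apply (a w : V) : auxP G k l μ a w =
    (if G.Adj a w then 1 else 0) + ((k : ℤ) - l + μ) * (if a = w then 1 else 0) := by
  rw [auxP, Matrix.add_apply, Matrix.smul_apply, SimpleGraph.adjMatrix_apply, Matrix.one_apply,
    smul_eq_mul]

lemma f_eq {a b : V} (hab : G.Adj a b) (f : V → ℤ)
    (hfu : f a = (k : ℤ) + μ - l - 1)
    (hfv : f b = -((k : ℤ) + μ - l - 1))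
    (hfw : ∀ w, w ≠ a → w ≠ b →
      f w = (if G.Adj w a then 1 else 0) - (if G.Adj w b then 1 else 0)) :
    Matrix.vecMul (chipDiff a b : V → ℤ) (auxP G k l μ) = f := by
  ext w
  have : Matrix.vecMul (chipDiff a b : V → ℤ) (auxP G k l μ) w
      = auxP G k l μ a w - auxP G k l μ b w := by
    simp [chipDiff, Matrix.sub_vecMul]
  rw [this]
  by_cases h1 : w = a
  · subst h1
    rw [hfu]
    simp [auxP_apply, hab.symm, hab.ne']
    ring
  by_cases h2 : w = b
  · subst h2
    rw [hfv]
    simp [auxP_apply, hab, hab.ne]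
    ring
  rw [hfw w h1 h2]
  simp [auxP_apply, Ne.symm h1, Ne.symm h2, G.adj_comm w]

lemma exists_diff_one (hsrg : G.IsSRGWith n k l μ) (hk : k + 2 ≤ n) (hl : l + 1 < k)
    (hnotbip : ¬(l = 0 ∧ μ = k)) {a b : V} (hab : G.Adj a b) (f : V → ℤ)
    (hfw : ∀ w, w ≠ a → w ≠ b →
      f w = (if G.Adj w a then 1 else 0) - (if G.Adj w b then 1 else 0)) :
    ∃ w w', f w - f w' = 1 := by
  have h1 : ∃ w, f w = 1 := by
    by_contra! hcon
    have hsub : G.neighborFinset a ⊆ insert b (G.commonNeighbors a b).toFinset := by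
      intro w hw
      rw [SimpleGraph.mem_neighborFinset] at hw
      by_cases hwb : w = b
      · simp [hwb]
      · have hc := hcon w
        rw [hfw w hw.ne' hwb] at hc
        simp only [mem_insert, Set.mem_toFinset]
        right
        refine ⟨hw, ?_⟩
        by_contra hnb
        apply hc
        have hnb' : ¬ G.Adj w b := fun h => hnb h.symm
        simp [hw.symm, hnb']
    have := (card_le_card hsub).trans (card_insert_le _ _)
    rw [SimpleGraph.card_neighborFinset_eq_degree, hsrg.regular a, Set.toFinset_card,
      hsrg.of_adj _ _ hab] at this
    omega
  have h0 : ∃ w, f w = 0 := by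
    by_cases hl0 : l = 0
    · by_contra! hcon
      have huniv : (univ : Finset V) ⊆ G.neighborFinset a ∪ G.neighborFinset b := by
        intro w _
        rw [mem_union, SimpleGraph.mem_neighborFinset, SimpleGraph.mem_neighborFinset]
        by_contra! hw
        have hwa : w ≠ a := by rintro rfl; exact hw.2 hab.symm
        have hwb : w ≠ b := by rintro rfl; exact hw.1 hab
        apply hcon w
        rw [hfw w hwa hwb, if_neg (fun h => hw.1 h.symm), if_neg (fun h => hw.2 h.symm)]
        rfl
      have hle := card_le_card huniv
      have hge := card_le_univ (G.neighborFinset a ∪ G.neighborFinset b)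
      rw [hsrg.card_neighborFinset_union_of_adj hab] at hle hge
      rw [card_univ, hsrg.card] at hle
      rw [hsrg.card] at hge
      have hn : n = 2 * k := by omega
      have h2 := hsrg.param_eq G (by omega)
      have e1 : n - k - 1 = k - 1 := by omega
      have e2 : k - l - 1 = k - 1 := by omega
      rw [e1, e2, mul_comm] at h2
      exact hnotbip ⟨hl0, (Nat.eq_of_mul_eq_mul_left (by omega) h2).symm⟩
    · have hc := hsrg.of_adj _ _ hab
      have : 0 < Fintype.card (G.commonNeighbors a b) := by omega
      rw [Fintype.card_pos_iff] at this
      obtain ⟨⟨w, hw1, hw2⟩⟩ := this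
      have hw1' : G.Adj w a := SimpleGraph.Adj.symm hw1
      have hw2' : G.Adj w b := SimpleGraph.Adj.symm hw2
      refine ⟨w, ?_⟩
      rw [hfw w hw1'.ne hw2'.ne]
      simp [hw1', hw2']
  obtain ⟨w, hw⟩ := h1
  obtain ⟨w', hw'⟩ := h0
  exact ⟨w, w', by rw [hw, hw']; rfl⟩

end graph

theorem stmt19 {V : Type*} [Fintype V] [DecidableEq V] (G : SimpleGraph V)
    [DecidableRel G.Adj] {n k l μ : ℕ}
    (hsrg : G.IsSRGWith n k l μ) (hconn : G.Connected)
    (hnotcomplete : ∃ x y : V, x ≠ y ∧ ¬G.Adj x y)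
    (hnotbip : ¬(l = 0 ∧ μ = k))
    (r : ℕ) (hr : 1 ≤ r) (u v : Fin r → V) (hadj : ∀ i, G.Adj (u i) (v i))
    (f : Fin r → V → ℤ)
    (hfu : ∀ i, f i (u i) = (k : ℤ) + μ - l - 1)
    (hfv : ∀ i, f i (v i) = -((k : ℤ) + μ - l - 1))
    (hfw : ∀ i w, w ≠ u i → w ≠ v i →
      f i w = (if G.Adj w (u i) then 1 else 0) - (if G.Adj w (v i) then 1 else 0))
    (horth : ∀ i j, i ≠ j → f i (u j) = f i (v j))
    (η : ℕ) (hη : η = k * n / Nat.gcd (2 * (n - 1)) (k * n)) :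
    ∃ φ : ZMod (n * μ) × (Fin (r - 1) → ZMod η) →+ critGroup G,
      Function.Injective φ := by
  obtain ⟨m, rfl⟩ : ∃ m, r = m + 1 := ⟨r - 1, by omega⟩
  have hμ := mu_pos hsrg hconn hnotcomplete
  have hk := k_add_two_le hsrg hnotcomplete
  have hl := l_add_one_lt hsrg hμ hk (hadj 0)
  have hpar := param_int hsrg hk hl
  obtain ⟨w, w', hww⟩ := exists_diff_one hsrg hk hl hnotbip (hadj 0) (f 0) (hfw 0)
  have hf : ∀ i, Matrix.vecMul (chipDiff (u i) (v i) : V → ℤ) (auxP G k l μ) = f i :=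
    fun i => f_eq (hadj i) (f i) (hfu i) (hfv i) (hfw i)
  let q : sumZero V →+ critGroup G :=
    QuotientAddGroup.mk' ((rowSpan (G.lapMatrix ℤ)).addSubgroupOf (sumZero V))
  have hq : ∀ x, q x = 0 ↔ (x : V → ℤ) ∈ rowSpan (G.lapMatrix ℤ) := by
    intro x
    have : q x = 0 ↔ x ∈ (rowSpan (G.lapMatrix ℤ)).addSubgroupOf (sumZero V) :=
      QuotientAddGroup.eq_zero_iff x
    rw [this, AddSubgroup.mem_addSubgroupOf]
  let D : Fin (m + 1) → critGroup G := fun i => q (chipDiff (u i) (v i))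
  have hD : ∀ i, ((n * μ : ℕ) : ℤ) • D i = 0 := by
    intro i
    simp only [D]
    rw [← map_zsmul, hq]
    have := smul_mem hsrg hk hl _ (chipDiff (u i) (v i)).2
    push_cast
    exact this
  have hrel : ∀ a : Fin (m + 1) → ℤ, ∑ i, a i • D i = 0 → ∀ z z' : V,
      ((n : ℤ) * μ) ∣ ∑ i, a i * (f i z - f i z') := by
    intro a ha z z'
    have e : ∑ i, a i • D i = q (∑ i, a i • chipDiff (u i) (v i)) := by
      simp [D, map_sum, map_zsmul]
    rw [e, hq] at ha
    have := dvd_of_mem hsrg hk hl _ ha z z'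
    have e2 : Matrix.vecMul ((∑ i, a i • chipDiff (u i) (v i) : sumZero V) : V → ℤ)
        (auxP G k l μ) = ∑ i, a i • f i := by
      rw [AddSubgroup.val_finsetSum, Matrix.sum_vecMul]
      apply Finset.sum_congr rfl
      intro i _
      rw [← hf i, AddSubgroup.coe_zsmul, Matrix.smul_vecMul]
    rw [e2] at this
    simpa [Finset.sum_apply, mul_sub, Finset.sum_sub_distrib] using this
  have hηd : ∀ t : ℤ, ((n : ℤ) * μ) ∣ t * (2 * ((k : ℤ) + μ - l - 1)) → (η : ℤ) ∣ t := by
    intro t ht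
    have h1 : ((k * n : ℕ) : ℤ) ∣ ((2 * (n - 1) : ℕ) : ℤ) * t := by
      have h2 : (μ : ℤ) * ((k : ℤ) * n) ∣ μ * ((2 * (n - 1)) * t) := by
        have := mul_dvd_mul_left (k : ℤ) ht
        have e1 : (k : ℤ) * (t * (2 * ((k : ℤ) + μ - l - 1))) = μ * ((2 * (n - 1)) * t) := by
          linear_combination 2 * t * hpar
        have e2 : (k : ℤ) * ((n : ℤ) * μ) = μ * ((k : ℤ) * n) := by ring
        rw [e1, e2] at this
        exact this
      have h3 := Int.dvd_of_mul_dvd_mul_left (by exact_mod_cast hμ.ne') h2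
      have hn1 : 1 ≤ n := by omega
      push_cast [Nat.cast_sub hn1]
      exact h3
    have hkn : 0 < k * n := Nat.mul_pos (by omega) (by omega)
    have h2 : k * n ∣ 2 * (n - 1) * t.natAbs := by
      have := Int.natAbs_dvd_natAbs.mpr h1
      rwa [Int.natAbs_mul, Int.natAbs_natCast, Int.natAbs_natCast] at this
    have hg : 0 < Nat.gcd (2 * (n - 1)) (k * n) := Nat.gcd_pos_of_pos_right _ hkn
    have hcop := Nat.coprime_div_gcd_div_gcd hg
    rw [Int.natCast_dvd, hη]
    apply hcop.symm.dvd_of_dvd_mul_left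
    apply Nat.dvd_of_mul_dvd_mul_left hg
    rw [← mul_assoc, Nat.mul_div_cancel' (Nat.gcd_dvd_right _ _),
      Nat.mul_div_cancel' (Nat.gcd_dvd_left _ _)]
    exact h2
  refine abstract_aux (n * μ) η m (Nat.mul_pos (by omega) hμ).ne' (D 0) (fun i => D i.succ)
    (hD 0) (fun i => hD i.succ) (fun i => f i.succ w - f i.succ w') ?_
  intro a b hab
  have h0 : ∑ i, (Fin.cons a b : Fin (m + 1) → ℤ) i • D i = 0 := by
    rw [Fin.sum_univ_succ]; simpa using hab
  have h1 := hrel _ h0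
  constructor
  · have := h1 w w'
    rw [Fin.sum_univ_succ, hww] at this
    push_cast
    simpa using this
  · intro j
    apply hηd
    have := h1 (u j.succ) (v j.succ)
    rw [Finset.sum_eq_single j.succ] at this
    · rw [hfu, hfv] at this
      simp only [Fin.cons_succ] at this
      convert this using 2
      ring
    · intro i _ hij
      rw [horth i j.succ hij]; simp
    · simp
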